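/- Let U ⊆ ℝⁿ be an open set, Z a compact topological space, and F : Z × ℝ → ℝⁿ a continuous open embedding (a homeomorphism onto an open subset of ℝⁿ) whose range is contained in U. If U \ F(Z × {0}) is preconnected, then U \ F(Z × [−1,1]) is preconnected. -/

import Mathlib

/-- A self-map of `ℝ` taking `ℝ \ {0}` onto `ℝ \ [-1, 1]` and fixing every `t` with `2 ≤ |t|`. -/
noncomputable def pushAway (t : ℝ) : ℝ := t + max 0 (1 - |t| / 2) * (t / |t|)

theorem continuousAt_pushAway {t : ℝ} (ht : t ≠ 0) : ContinuousAt pushAway t := by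
  have h : |t| ≠ 0 := abs_ne_zero.mpr ht
  unfold pushAway
  fun_prop (disch := assumption)

theorem pushAway_eq_self {t : ℝ} (ht : 2 ≤ |t|) : pushAway t = t := by
  rw [pushAway, max_eq_left (by linarith)]
  ring

theorem pushAway_of_pos {t : ℝ} (ht : 0 < t) : pushAway t = t + max 0 (1 - t / 2) := by
  rw [pushAway, abs_of_pos ht, div_self ht.ne', mul_one]

theorem pushAway_neg (t : ℝ) : pushAway (-t) = -pushAway t := by
  rw [pushAway, pushAway, abs_neg]
  ring

theorem pushAway_notMem_Icc {t : ℝ} (ht : t ≠ 0) : pushAway t ∉ Set.Icc (-1 : ℝ) 1 := by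
  have pos_case {s : ℝ} (hs : 0 < s) : 1 < pushAway s := by
    rw [pushAway_of_pos hs]
    linarith [le_max_right 0 (1 - s / 2)]
  rintro ⟨h₁, h₂⟩
  rcases ht.lt_or_gt with h | h
  · have := pos_case (neg_pos.mpr h)
    rw [pushAway_neg] at this
    linarith
  · linarith [pos_case h]

theorem exists_pushAway_eq {s : ℝ} (hs : s ∉ Set.Icc (-1 : ℝ) 1) :
    ∃ t, t ≠ 0 ∧ pushAway t = s := by
  have pos_case {s : ℝ} (hs : 1 < s) : ∃ t, t ≠ 0 ∧ pushAway t = s := by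
    rcases le_total 2 s with h | h
    · exact ⟨s, by linarith, pushAway_eq_self (h.trans (le_abs_self s))⟩
    · refine ⟨2 * (s - 1), by linarith, ?_⟩
      rw [pushAway_of_pos (by linarith), max_eq_right (by linarith)]
      ring
  by_cases h : 1 < s
  · exact pos_case h
  · have hs' : 1 < -s := by
      by_contra h'
      exact hs ⟨by linarith, by linarith⟩
    obtain ⟨t, ht, hts⟩ := pos_case hs'
    exact ⟨-t, neg_ne_zero.mpr ht, by rw [pushAway_neg, hts, neg_neg]⟩

/-- Removing a closed collar of a bicollared compact set instead of the set itself preserves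
preconnectedness of the complement, in any Hausdorff space. -/
theorem IsPreconnected.diff_image_collar {X Z : Type*} [TopologicalSpace X] [T2Space X]
    [TopologicalSpace Z] [CompactSpace Z] {U : Set X} {F : Z × ℝ → X}
    (hF : Topology.IsOpenEmbedding F) (hrange : Set.range F ⊆ U)
    (hconn : IsPreconnected (U \ F '' (Set.univ ×ˢ ({0} : Set ℝ)))) :
    IsPreconnected (U \ F '' (Set.univ ×ˢ Set.Icc (-1 : ℝ) 1)) := by
  have mem_image (S : Set ℝ) (p : Z × ℝ) : F p ∈ F '' (Set.univ ×ˢ S) ↔ p.2 ∈ S := by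
    rw [hF.injective.mem_set_image]
    simp
  let Φ : Z × ℝ → Z × ℝ := fun p ↦ (p.1, pushAway p.2)
  let g : X → X := Function.extend F (F ∘ Φ) id
  have g_apply (p : Z × ℝ) : g (F p) = F (Φ p) := hF.injective.extend_apply _ _ p
  have g_of_notMem {x : X} (hx : x ∉ Set.range F) : g x = x :=
    Function.extend_apply' _ _ x hx
  have g_cont : ContinuousOn g (U \ F '' (Set.univ ×ˢ ({0} : Set ℝ))) := by
    rintro x ⟨-, hx⟩
    apply ContinuousAt.continuousWithinAt
    by_cases hxF : x ∈ Set.range F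
    · obtain ⟨p, rfl⟩ := hxF
      have hp : p.2 ≠ 0 := fun h ↦ hx ((mem_image {0} p).mpr h)
      rw [← hF.continuousAt_iff]
      have hgF : g ∘ F = F ∘ Φ := funext g_apply
      rw [hgF]
      exact hF.continuous.continuousAt.comp
        (continuousAt_fst.prodMk ((continuousAt_pushAway hp).comp continuousAt_snd))
    · have hclosed : IsClosed (F '' (Set.univ ×ˢ Set.Icc (-2 : ℝ) 2)) :=
        ((isCompact_univ.prod isCompact_Icc).image hF.continuous).isClosed
      have hnhds : (F '' (Set.univ ×ˢ Set.Icc (-2 : ℝ) 2))ᶜ ∈ nhds x :=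
        hclosed.isOpen_compl.mem_nhds fun h ↦ hxF (Set.image_subset_range _ _ h)
      refine continuousAt_id.congr ?_
      filter_upwards [hnhds] with y hy
      by_cases hyF : y ∈ Set.range F
      · obtain ⟨p, rfl⟩ := hyF
        have hp : 2 ≤ |p.2| := by
          by_contra! h
          exact hy ((mem_image _ p).mpr (abs_le.mp h.le))
        rw [g_apply, id]
        exact congrArg F (Prod.ext rfl (pushAway_eq_self hp).symm)
      · exact (g_of_notMem hyF).symm
  convert hconn.image g g_cont using 1
  apply Set.Subset.antisymm
  · rintro y ⟨hyU, hy⟩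
    by_cases hyF : y ∈ Set.range F
    · obtain ⟨⟨z, s⟩, rfl⟩ := hyF
      obtain ⟨t, ht, rfl⟩ := exists_pushAway_eq fun h ↦ hy ((mem_image _ (z, s)).mpr h)
      exact ⟨F (z, t), ⟨hrange ⟨_, rfl⟩, fun h ↦ ht ((mem_image _ _).mp h)⟩, g_apply _⟩
    · exact ⟨y, ⟨hyU, fun h ↦ hyF (Set.image_subset_range _ _ h)⟩, g_of_notMem hyF⟩
  · rintro _ ⟨x, ⟨hxU, hx⟩, rfl⟩
    by_cases hxF : x ∈ Set.range F
    · obtain ⟨p, rfl⟩ := hxF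
      rw [g_apply]
      exact ⟨hrange ⟨_, rfl⟩, fun h ↦ pushAway_notMem_Icc
        (fun h₀ ↦ hx ((mem_image {0} p).mpr h₀)) ((mem_image _ _).mp h)⟩
    · rw [g_of_notMem hxF]
      exact ⟨hxU, fun h ↦ hxF (Set.image_subset_range _ _ h)⟩


/-- If `F : Z × ℝ → ℝⁿ` is a continuous open embedding with range contained
in the open set `U` and `Z` compact, and `U \ F(Z × {0})` is preconnected, then
`U \ F(Z × [-1,1])` is preconnected. -/
theorem stmt_4 (n : ℕ) (U : Set (EuclideanSpace ℝ (Fin n))) (hU : IsOpen U)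
    (Z : Type*) [TopologicalSpace Z] [CompactSpace Z]
    (F : Z × ℝ → EuclideanSpace ℝ (Fin n)) (hF : Topology.IsOpenEmbedding F)
    (hrange : Set.range F ⊆ U)
    (hconn : IsPreconnected (U \ F '' (Set.univ ×ˢ ({0} : Set ℝ)))) :
    IsPreconnected (U \ F '' (Set.univ ×ˢ Set.Icc (-1 : ℝ) 1)) := by
  exact hconn.diff_image_collar hF hrange
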